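/- Let F ∈ ℝ^{n×n} be invertible, G ∈ ℝ^{n×m}, K ∈ ℝ^{m×n}, L ∈ ℝ^{n×p}, and let Σ ∈ ℝ^{p×p} be symmetric positive definite with symmetric square root S = Σ^{1/2}. Let ν̄ > 0, α > 0, let R₁ ∈ ℝ^{n×n} be symmetric positive definite, and fix k ≥ 2. Set H_i = (F + GK)ⁱ − Fⁱ and assume that for each i ∈ {1, …, k−1} the matrix α H_i L Σ Lᵀ H_iᵀ is positive definite. Let {Q₁, …, Q_N} be the collection of the k matrices ν̄ Fⁱ R₁ (Fⁱ)ᵀ for i = 0, …, k−1 together with the k−1 matrices α H_i L Σ Lᵀ H_iᵀ for i = 1, …, k−1, and define Q*_k = ( Σ_{r=1}^N √(tr(Q_r)) ) · ( Σ_{r=1}^N Q_r / √(tr(Q_r)) ). Suppose (ν_j) and (δ_j) satisfy ν_jᵀ R₁⁻¹ ν_j ≤ ν̄ and δ_jᵀ δ_j ≤ α for all j, and define (e_k), (x_k) by e₀ = 0, x₀ = 0, e_{j+1} = F e_j − L S δ_j + ν_j, x_{j+1} = (F + GK) x_j − GK e_j + ν_j. Then x_k ∈ E(Q*_k). -/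

import Mathlib

open Matrix Finset

/-- Cauchy–Schwarz for the form induced by a positive semidefinite real matrix. -/
theorem Matrix.PosSemidef.sq_dotProduct_mulVec_le {ι : Type*} [Fintype ι]
    {R : Matrix ι ι ℝ} (hR : R.PosSemidef) (a b : ι → ℝ) :
    (a ⬝ᵥ (R *ᵥ b)) ^ 2 ≤ (a ⬝ᵥ (R *ᵥ a)) * (b ⬝ᵥ (R *ᵥ b)) := by
  have hsymm : b ⬝ᵥ (R *ᵥ a) = a ⬝ᵥ (R *ᵥ b) := by
    have hT : Rᵀ = R := by simpa using hR.isHermitian.eq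
    rw [dotProduct_mulVec, ← mulVec_transpose, hT, dotProduct_comm]
  have h := discrim_le_zero (a := b ⬝ᵥ (R *ᵥ b)) (b := 2 * (a ⬝ᵥ (R *ᵥ b)))
    (c := a ⬝ᵥ (R *ᵥ a)) fun t => by
      have ht := hR.dotProduct_mulVec_nonneg (a + t • b)
      simp only [star_trivial, mulVec_add, mulVec_smul, add_dotProduct, dotProduct_add,
        smul_dotProduct, dotProduct_smul, smul_eq_mul, hsymm] at ht
      linarith
  rw [discrim] at h
  linarith

/-- The linear image `M E(c R)` has support function `u ↦ √(uᵀ (c M R Mᵀ) u)`. -/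
theorem Matrix.PosDef.sq_dotProduct_mulVec_le_of_inv_le {ι κ : Type*} [Fintype ι] [Fintype κ]
    [DecidableEq κ] {R : Matrix κ κ ℝ} (hR : R.PosDef) (M : Matrix ι κ ℝ) {c : ℝ} {v : κ → ℝ}
    (hv : v ⬝ᵥ (R⁻¹ *ᵥ v) ≤ c) (u : ι → ℝ) :
    (u ⬝ᵥ (M *ᵥ v)) ^ 2 ≤ u ⬝ᵥ ((c • (M * R * Mᵀ)) *ᵥ u) := by
  have hcancel : R *ᵥ (R⁻¹ *ᵥ v) = v := by
    rw [mulVec_mulVec, mul_nonsing_inv _ ((isUnit_iff_isUnit_det R).mp hR.isUnit), one_mulVec]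
  have hadj (w : κ → ℝ) : u ⬝ᵥ (M *ᵥ w) = (Mᵀ *ᵥ u) ⬝ᵥ w := by
    rw [dotProduct_mulVec, mulVec_transpose]
  have hcs := hR.posSemidef.sq_dotProduct_mulVec_le (Mᵀ *ᵥ u) (R⁻¹ *ᵥ v)
  have hnonneg := hR.posSemidef.dotProduct_mulVec_nonneg (Mᵀ *ᵥ u)
  rw [star_trivial] at hnonneg
  rw [hcancel, dotProduct_comm (R⁻¹ *ᵥ v)] at hcs
  rw [hadj, smul_mulVec, dotProduct_smul, ← mulVec_mulVec, ← mulVec_mulVec, hadj, smul_eq_mul]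
  nlinarith

/-- A vector dominated by the support function of `E(Q)` lies in `E(Q)`. -/
theorem Matrix.dotProduct_inv_mulVec_le_one {ι : Type*} [Fintype ι] [DecidableEq ι]
    {Q : Matrix ι ι ℝ} {v : ι → ℝ} (h : ∀ u, (u ⬝ᵥ v) ^ 2 ≤ u ⬝ᵥ (Q *ᵥ u)) :
    v ⬝ᵥ (Q⁻¹ *ᵥ v) ≤ 1 := by
  by_cases hQ : IsUnit Q.det
  · have hv := h (Q⁻¹ *ᵥ v)
    rw [mulVec_mulVec, mul_nonsing_inv _ hQ, one_mulVec, dotProduct_comm] at hv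
    nlinarith
  · simp [nonsing_inv_apply_not_isUnit _ hQ]

/-- The trace-weighted combination of ellipsoids contains their Minkowski sum. -/
theorem Matrix.sum_mem_traceWeighted_ellipsoid {ι κ : Type*} [Fintype ι] [DecidableEq ι]
    [Nonempty ι] (s : Finset κ) {Q : κ → Matrix ι ι ℝ} {v : κ → ι → ℝ}
    (hQ : ∀ r ∈ s, (Q r).PosDef)
    (hv : ∀ r ∈ s, ∀ u, (u ⬝ᵥ v r) ^ 2 ≤ u ⬝ᵥ (Q r *ᵥ u)) :
    (∑ r ∈ s, v r) ⬝ᵥ (((∑ r ∈ s, √(Q r).trace) •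
      ∑ r ∈ s, (√(Q r).trace)⁻¹ • Q r)⁻¹ *ᵥ ∑ r ∈ s, v r) ≤ 1 := by
  refine dotProduct_inv_mulVec_le_one fun u => ?_
  rw [dotProduct_sum, smul_mulVec, dotProduct_smul, sum_mulVec, dotProduct_sum, smul_eq_mul]
  refine sum_sq_le_sum_mul_sum_of_sq_le_mul s (fun r _ => Real.sqrt_nonneg _) (fun r hr => ?_)
    fun r hr => ?_
  · rw [smul_mulVec, dotProduct_smul, smul_eq_mul]
    exact mul_nonneg (by positivity) ((sq_nonneg _).trans (hv r hr u))
  · have hpos : 0 < √(Q r).trace := Real.sqrt_pos.mpr (hQ r hr).trace_pos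
    rw [smul_mulVec, dotProduct_smul, smul_eq_mul, mul_inv_cancel_left₀ hpos.ne']
    exact hv r hr u

/-- Variation of constants for a discrete-time linear recursion started at zero. -/
theorem Matrix.linear_recursion_eq_sum {ι : Type*} [Fintype ι] [DecidableEq ι]
    {A : Matrix ι ι ℝ} {y w : ℕ → ι → ℝ} (h0 : y 0 = 0)
    (hy : ∀ j, y (j + 1) = A *ᵥ y j + w j) (k : ℕ) :
    y k = ∑ i ∈ range k, A ^ i *ᵥ w (k - 1 - i) := by
  induction k with
  | zero => simp [h0]
  | succ k ih =>
    rw [hy, ih, sum_range_succ', mulVec_sum]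
    congr 1
    · refine sum_congr rfl fun i hi => ?_
      rw [mulVec_mulVec, ← pow_succ']
      congr 2
      omega
    · simp

/-- With `Q*_k` the minimum-trace combination
`(Σ_r √tr(Q_r)) · (Σ_r Q_r / √tr(Q_r))` of the collection consisting of the matrices
`νbar Fⁱ R₁ (Fⁱ)ᵀ`, `i = 0, …, k−1`, and `α H_i L Σ Lᵀ H_iᵀ`, `i = 1, …, k−1`, the
`k`-step state of the attacked closed-loop system satisfies `x_k ∈ E(Q*_k)`. -/
theorem stmt_13 {n m p : ℕ}
    (F : Matrix (Fin n) (Fin n) ℝ) (hF : IsUnit F)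
    (G : Matrix (Fin n) (Fin m) ℝ) (K : Matrix (Fin m) (Fin n) ℝ)
    (L : Matrix (Fin n) (Fin p) ℝ)
    (Sig S : Matrix (Fin p) (Fin p) ℝ)
    (hSig : Sig.PosDef) (hSigsymm : Sig.IsSymm)
    (hS : S.PosDef) (hSsymm : S.IsSymm) (hSS : S * S = Sig)
    (νbar α : ℝ) (hνbar : 0 < νbar) (hα : 0 < α)
    (R₁ : Matrix (Fin n) (Fin n) ℝ) (hR₁ : R₁.PosDef) (hR₁symm : R₁.IsSymm)
    (k : ℕ) (hk : 2 ≤ k)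
    (H : ℕ → Matrix (Fin n) (Fin n) ℝ) (hH : ∀ i, H i = (F + G * K) ^ i - F ^ i)
    (hHpd : ∀ i, 1 ≤ i → i < k → (α • (H i * L * Sig * Lᵀ * (H i)ᵀ)).PosDef)
    (Qstar : Matrix (Fin n) (Fin n) ℝ)
    (hQstar : Qstar =
      ((∑ i ∈ range k, Real.sqrt ((νbar • (F ^ i * R₁ * (F ^ i)ᵀ)).trace)) +
       (∑ i ∈ Ico 1 k, Real.sqrt ((α • (H i * L * Sig * Lᵀ * (H i)ᵀ)).trace))) •
      ((∑ i ∈ range k, (Real.sqrt ((νbar • (F ^ i * R₁ * (F ^ i)ᵀ)).trace))⁻¹ •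
          (νbar • (F ^ i * R₁ * (F ^ i)ᵀ))) +
       (∑ i ∈ Ico 1 k, (Real.sqrt ((α • (H i * L * Sig * Lᵀ * (H i)ᵀ)).trace))⁻¹ •
          (α • (H i * L * Sig * Lᵀ * (H i)ᵀ)))))
    (ν : ℕ → Fin n → ℝ) (δ : ℕ → Fin p → ℝ)
    (hν : ∀ j, ν j ⬝ᵥ (R₁⁻¹ *ᵥ ν j) ≤ νbar) (hδ : ∀ j, δ j ⬝ᵥ δ j ≤ α)
    (e x : ℕ → Fin n → ℝ) (he0 : e 0 = 0) (hx0 : x 0 = 0)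
    (he : ∀ j, e (j + 1) = F *ᵥ e j - L *ᵥ (S *ᵥ δ j) + ν j)
    (hx : ∀ j, x (j + 1) = (F + G * K) *ᵥ x j - (G * K) *ᵥ e j + ν j) :
    x k ⬝ᵥ (Qstar⁻¹ *ᵥ x k) ≤ 1 := by
  rcases n with _ | n
  · simp [dotProduct]
  have hk0 : range k = insert 0 (Ico 1 k) := by
    ext i; simp only [Finset.mem_range, Finset.mem_insert, Finset.mem_Ico]; omega
  have hek := linear_recursion_eq_sum (A := F) (w := fun j => ν j - L *ᵥ (S *ᵥ δ j)) he0
    (fun j => by rw [he]; abel) k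
  have hyk := linear_recursion_eq_sum (A := F + G * K) (y := fun j => x j - e j)
    (w := fun j => L *ᵥ (S *ᵥ δ j)) (by simp [he0, hx0])
    (fun j => by simp only [hx, he, mulVec_sub, add_mulVec]; abel) k
  have hxk : x k = ∑ i ∈ range k, F ^ i *ᵥ ν (k - 1 - i) +
      ∑ i ∈ Ico 1 k, (H i * L * S) *ᵥ δ (k - 1 - i) := by
    have hsum : ∑ i ∈ Ico 1 k, (H i * L * S) *ᵥ δ (k - 1 - i) =
        ∑ i ∈ range k, (H i * L * S) *ᵥ δ (k - 1 - i) := by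
      rw [hk0, sum_insert (by simp)]
      simp [hH 0]
    rw [hsum, ← sum_add_distrib, ← sub_add_cancel (x k) (e k), hyk, hek, ← sum_add_distrib]
    refine sum_congr rfl fun i _ => ?_
    simp only [hH, ← mulVec_mulVec, mulVec_sub, sub_mulVec]
    abel
  have hST : Sᵀ = S := hSsymm
  have hQH (i : ℕ) : H i * L * Sig * Lᵀ * (H i)ᵀ =
      H i * L * S * (1 : Matrix (Fin p) (Fin p) ℝ) * (H i * L * S)ᵀ := by
    simp only [← hSS, transpose_mul, hST, Matrix.mul_assoc, Matrix.one_mul]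
  have hmem := sum_mem_traceWeighted_ellipsoid ((range k).disjSum (Ico 1 k))
    (Q := Sum.elim (fun i => νbar • (F ^ i * R₁ * (F ^ i)ᵀ))
      fun i => α • (H i * L * Sig * Lᵀ * (H i)ᵀ))
    (v := Sum.elim (fun i => F ^ i *ᵥ ν (k - 1 - i))
      fun i => (H i * L * S) *ᵥ δ (k - 1 - i)) ?_ ?_
  · simpa only [sum_disjSum, Sum.elim_inl, Sum.elim_inr, ← hxk, ← hQstar] using hmem
  · rintro (i | i) hi
    · refine PosDef.smul ?_ hνbar
      have h := (hF.pow i).posDef_star_right_conjugate_iff.mpr hR₁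
      rwa [star_eq_conjTranspose, conjTranspose_eq_transpose_of_trivial] at h
    · have hi' := Finset.mem_Ico.mp (inr_mem_disjSum.mp hi)
      exact hHpd i hi'.1 hi'.2
  · rintro (i | i) - u
    · exact hR₁.sq_dotProduct_mulVec_le_of_inv_le _ (hν _) u
    · simp only [Sum.elim_inr, hQH]
      exact PosDef.one.sq_dotProduct_mulVec_le_of_inv_le _ (by simpa using hδ _) u
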